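/- Let p be a prime number, let a be a real number with |a| < 2√p, and let T ∈ ℝ. Then the set { s ∈ ℂ : 1 − a·p^{−(s+1/2)} + p^{−2s} = 0 and T ≤ Im(s) < T + 1 } is finite with at most (log p)/π + 2 elements. (On any vertical interval of length 1, a good-reduction local factor has O(log p) poles.) -/

import Mathlib

/-- The inverse local Euler factor at a prime of good reduction,
in analytic normalization: `f p a s = 1 - a·p^{-(s+1/2)} + p^{-2s}`,
where `p^z := exp (z · log p)`. -/
noncomputable def goodLocalFactorInv (p : ℕ) (a : ℝ) (s : ℂ) : ℂ :=
  1 - (a : ℂ) * Complex.exp (-(s + 1/2) * (Real.log p : ℂ))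
    + Complex.exp (-(2 * s) * (Real.log p : ℂ))

/-- For `L > 0`, the solutions of `exp (-s L) = u` in a horizontal strip of height one form
a finite set of at most `L / (2π) + 1` points. -/
theorem finite_ncard_exp_neg_mul_eq_in_unit_strip {L : ℝ} (hL : 0 < L) (u : ℂ) (T : ℝ) :
    {s : ℂ | Complex.exp (-s * (L : ℂ)) = u ∧ T ≤ s.im ∧ s.im < T + 1}.Finite ∧
    ({s : ℂ | Complex.exp (-s * (L : ℂ)) = u ∧ T ≤ s.im ∧ s.im < T + 1}.ncard : ℝ)
      ≤ L / (2 * Real.pi) + 1 := by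
  have hpi := Real.pi_pos
  rcases Set.eq_empty_or_nonempty
    {s : ℂ | Complex.exp (-s * (L : ℂ)) = u ∧ T ≤ s.im ∧ s.im < T + 1} with h | ⟨s₀, hs₀, -, -⟩
  · rw [h]
    refine ⟨Set.finite_empty, ?_⟩
    simp only [Set.ncard_empty, Nat.cast_zero]
    positivity
  set ℓ : ℝ := L / (2 * Real.pi) with hℓ
  have hℓ_pos : 0 < ℓ := by positivity
  set x : ℝ := (T - s₀.im) * ℓ with hx
  set F : Finset ℂ := (Finset.Ico ⌈x⌉ ⌈x + ℓ⌉).image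
    (fun k : ℤ => s₀ + k * ((ℓ⁻¹ : ℝ) : ℂ) * Complex.I) with hF
  have hsub : {s : ℂ | Complex.exp (-s * (L : ℂ)) = u ∧ T ≤ s.im ∧ s.im < T + 1} ⊆ (F : Set ℂ) := by
    rintro s ⟨hs, h1, h2⟩
    obtain ⟨n, hn⟩ := Complex.exp_eq_exp_iff_exists_int.mp (hs₀.trans hs.symm)
    have hLc : (L : ℂ) ≠ 0 := by exact_mod_cast hL.ne'
    have hs_eq : s = s₀ + n * ((ℓ⁻¹ : ℝ) : ℂ) * Complex.I := by
      have : ((ℓ⁻¹ : ℝ) : ℂ) = 2 * Real.pi / L := by rw [hℓ, inv_div]; push_cast; rfl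
      rw [this]
      field_simp
      linear_combination hn
    have him : s.im = s₀.im + n * ℓ⁻¹ := by
      rw [hs_eq]
      simp
    have hmul : (s.im - s₀.im) * ℓ = n := by
      rw [him]
      field_simp
      ring
    rw [hF, Finset.coe_image]
    refine ⟨n, ?_, hs_eq.symm⟩
    rw [Finset.mem_coe, Finset.mem_Ico, Int.ceil_le, Int.lt_ceil, ← hmul]
    constructor <;> nlinarith
  refine ⟨F.finite_toSet.subset hsub, ?_⟩
  have hcard : ({s : ℂ | Complex.exp (-s * (L : ℂ)) = u ∧ T ≤ s.im ∧ s.im < T + 1}.ncard : ℝ)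
      ≤ ((⌈x + ℓ⌉ - ⌈x⌉).toNat : ℝ) := by
    have h := Set.ncard_le_ncard hsub F.finite_toSet
    rw [Set.ncard_coe_finset] at h
    exact_mod_cast h.trans (Finset.card_image_le.trans_eq (Int.card_Ico _ _))
  have hle : ⌈x⌉ ≤ ⌈x + ℓ⌉ := Int.ceil_le_ceil (by linarith)
  have hcast : ((⌈x + ℓ⌉ - ⌈x⌉).toNat : ℝ) = (⌈x + ℓ⌉ : ℝ) - ⌈x⌉ := by
    have h := Int.toNat_of_nonneg (sub_nonneg.mpr hle)
    exact_mod_cast congrArg (Int.cast : ℤ → ℝ) h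
  linarith [Int.ceil_lt_add_one (x + ℓ), Int.le_ceil x]

/-- The inverse local factor is a quadratic polynomial in `exp (-s log p)`. -/
theorem goodLocalFactorInv_eq_quadratic (p : ℕ) (a : ℝ) (s : ℂ) :
    goodLocalFactorInv p a s =
      Complex.exp (-s * (Real.log p : ℂ)) ^ 2
        - a * Complex.exp (-(1 / 2) * (Real.log p : ℂ)) * Complex.exp (-s * (Real.log p : ℂ))
        + 1 := by
  have h1 : Complex.exp (-(s + 1 / 2) * (Real.log p : ℂ)) =
      Complex.exp (-(1 / 2) * (Real.log p : ℂ)) * Complex.exp (-s * (Real.log p : ℂ)) := by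
    rw [← Complex.exp_add]
    ring_nf
  have h2 : Complex.exp (-(2 * s) * (Real.log p : ℂ)) =
      Complex.exp (-s * (Real.log p : ℂ)) ^ 2 := by
    rw [← Complex.exp_nat_mul]
    push_cast
    ring_nf
  rw [goodLocalFactorInv, h1, h2]
  ring

/-- on any vertical interval `T ≤ Im s < T + 1` of length one, a
good-reduction inverse local factor has finitely many zeros, at most
`(log p)/π + 2` of them. -/
theorem good_reduction_zeros_in_unit_strip
    (p : ℕ) (hp : p.Prime) (a : ℝ) (ha : |a| < 2 * Real.sqrt p) (T : ℝ) :
    {s : ℂ | goodLocalFactorInv p a s = 0 ∧ T ≤ s.im ∧ s.im < T + 1}.Finite ∧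
    (({s : ℂ | goodLocalFactorInv p a s = 0 ∧ T ≤ s.im ∧ s.im < T + 1}.ncard : ℝ)
      ≤ Real.log p / Real.pi + 2) := by
  have hL : 0 < Real.log p := Real.log_pos (by exact_mod_cast hp.one_lt)
  have hpi := Real.pi_pos
  rcases Set.eq_empty_or_nonempty
    {s : ℂ | goodLocalFactorInv p a s = 0 ∧ T ≤ s.im ∧ s.im < T + 1} with h | ⟨s₀, hs₀, -, -⟩
  · rw [h]
    refine ⟨Set.finite_empty, ?_⟩
    simp only [Set.ncard_empty, Nat.cast_zero]
    positivity
  rw [goodLocalFactorInv_eq_quadratic] at hs₀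
  set u := Complex.exp (-s₀ * (Real.log p : ℂ))
  set b := (a : ℂ) * Complex.exp (-(1 / 2) * (Real.log p : ℂ)) with hb
  obtain ⟨hfin₁, hcard₁⟩ := finite_ncard_exp_neg_mul_eq_in_unit_strip hL u T
  obtain ⟨hfin₂, hcard₂⟩ := finite_ncard_exp_neg_mul_eq_in_unit_strip hL (b - u) T
  have hsub : {s : ℂ | goodLocalFactorInv p a s = 0 ∧ T ≤ s.im ∧ s.im < T + 1} ⊆
      {s : ℂ | Complex.exp (-s * (Real.log p : ℂ)) = u ∧ T ≤ s.im ∧ s.im < T + 1} ∪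
      {s : ℂ | Complex.exp (-s * (Real.log p : ℂ)) = b - u ∧ T ≤ s.im ∧ s.im < T + 1} := by
    rintro s ⟨hs, hT⟩
    rw [goodLocalFactorInv_eq_quadratic, ← hb] at hs
    have hprod : (Complex.exp (-s * (Real.log p : ℂ)) - u) *
        (Complex.exp (-s * (Real.log p : ℂ)) - (b - u)) = 0 := by
      linear_combination hs - hs₀
    rcases mul_eq_zero.mp hprod with h | h
    · exact Or.inl ⟨sub_eq_zero.mp h, hT⟩
    · exact Or.inr ⟨sub_eq_zero.mp h, hT⟩
  refine ⟨(hfin₁.union hfin₂).subset hsub, ?_⟩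
  have hle := (Set.ncard_le_ncard hsub (hfin₁.union hfin₂)).trans (Set.ncard_union_le _ _)
  have hle' := (Nat.cast_le (α := ℝ)).mpr hle
  rw [Nat.cast_add] at hle'
  have hhalf : Real.log p / Real.pi = 2 * (Real.log p / (2 * Real.pi)) := by
    field_simp
  linarith
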